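/- Let G be a group with an involution φ. If φ is non-trivial (i.e., G_φ ≠ G), then the subgroup K = ⟨g ∈ G : g ∉ G_φ⟩ has index at most 2 in G. -/

import Mathlib

/-- If an involution `φ` on a group `G` is non-trivial, then the subgroup generated by the
elements not fixed by `φ` has index at most 2 in `G`. -/
theorem index_closure_nonfixed_le_two
    {G : Type*} [Group G] (φ : G → G)
    (hmul : ∀ g h : G, φ (g * h) = φ h * φ g)
    (hinv : ∀ g : G, φ (φ g) = g)
    (hnt : ∃ g : G, φ g ≠ g) :
    (Subgroup.closure {g : G | φ g ≠ g}).index = 1 ∨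
      (Subgroup.closure {g : G | φ g ≠ g}).index = 2 := by
  set K := Subgroup.closure {g : G | φ g ≠ g}
  have mem_of_ne : ∀ g, φ g ≠ g → g ∈ K := fun g hg => Subgroup.subset_closure hg
  have fixed : ∀ g, g ∉ K → φ g = g := fun g hg => by
    by_contra h
    exact hg (mem_of_ne g h)
  have conj : ∀ x, x ∉ K → ∀ k ∈ K, φ k * x = x * k := fun x hx k hk => by
    have h := fixed (x * k) (fun h => hx ((K.mul_mem_cancel_right hk).1 h))
    rwa [hmul, fixed x hx] at h
  obtain ⟨k, hk⟩ := hnt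
  have hkK : k ∈ K := mem_of_ne k hk
  have hφkK : φ k ∈ K := mem_of_ne _ fun h => hk (by rw [← h, hinv])
  have mul_mem : ∀ a b, a ∉ K → b ∉ K → a * b ∈ K := fun a b ha hb => by
    by_contra hab
    have h₁ := conj (a * b) hab k hkK
    have h₂ := conj a ha (φ k) hφkK
    have h₃ := conj b hb k hkK
    rw [hinv] at h₂
    rw [mul_assoc, ← h₃, ← mul_assoc, ← mul_assoc, ← h₂, mul_assoc, mul_assoc] at h₁
    exact hk (mul_right_cancel h₁)
  by_cases hT : K = ⊤
  · exact Or.inl (Subgroup.index_eq_one.2 hT)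
  · right
    obtain ⟨a, ha⟩ : ∃ a, a ∉ K := by
      by_contra! h
      exact hT ((Subgroup.eq_top_iff' K).2 h)
    refine Subgroup.index_eq_two_iff.2 ⟨a, fun b => ?_⟩
    by_cases hb : b ∈ K
    · exact Or.inr ⟨hb, fun h => ha ((K.mul_mem_cancel_left hb).1 h)⟩
    · exact Or.inl ⟨mul_mem b a hb ha, hb⟩
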